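/- arXiv:2204.01798 — 8 statements merged into one kernel-verified Lean document; each statement's English description precedes it below -/
import Mathlib

section
/- For every A ∈ I⁺ there exists B ⊆ A such that B is r-shift-increasing, B ≠ ∅, and for every i ∈ B and every j < ω there exists n ∈ B ∩ A_{i,j} with n ≠ i. -/
/-- `A ⊆ ω` is *scattered* if there is no `B ⊆ A` such that the subspace
`{x n : n ∈ B}` of `X` is homeomorphic to `ℚ`. -/
def IsScattered {X : Type*} [TopologicalSpace X] (x : ℕ → X) (A : Set ℕ) : Prop :=
  ¬ ∃ B ⊆ A, Nonempty ((x '' B : Set X) ≃ₜ ℚ)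

/-- `d` (with `d n m` the distance between `x n` and `x m`) is a metric on the set
`{x n : n < ω}` which is compatible with the subspace topology inherited from `X`. -/
def IsCompatMetric {X : Type*} [TopologicalSpace X] (x : ℕ → X) (d : ℕ → ℕ → ℝ) : Prop :=
  (∀ n m, d n m = 0 ↔ n = m) ∧
  (∀ n m, d n m = d m n) ∧
  (∀ n m k, d n k ≤ d n m + d m k) ∧
  (∀ (n : ℕ) (U : Set X), IsOpen U → x n ∈ U → ∃ ε > 0, ∀ m, d m n < ε → x m ∈ U) ∧
  (∀ (n : ℕ) (ε : ℝ), 0 < ε → ∃ U : Set X, IsOpen U ∧ x n ∈ U ∧ ∀ m, x m ∈ U → d m n < ε)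

/-- `A_{i,j} = {n < ω : d(x_n, x_i) < 1/(j+1)}`. -/
def Aij (d : ℕ → ℕ → ℝ) (i j : ℕ) : Set ℕ := {n | d n i < 1 / ((j : ℝ) + 1)}

namespace ShiftInc

open Filter

/-- Dense-in-itself index sets. -/
def Crowded (d : ℕ → ℕ → ℝ) (C : Set ℕ) : Prop :=
  ∀ i ∈ C, ∀ ε > 0, ∃ n ∈ C, n ≠ i ∧ d n i < ε

/-- Sets containing a nonempty crowded set. -/
def Pos (d : ℕ → ℕ → ℝ) (S : Set ℕ) : Prop :=
  ∃ C ⊆ S, C.Nonempty ∧ Crowded d C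

/-- The metric axioms. -/
structure IsMet (d : ℕ → ℕ → ℝ) : Prop where
  eq0 : ∀ n m, d n m = 0 ↔ n = m
  symm : ∀ n m, d n m = d m n
  tri : ∀ n m k, d n k ≤ d n m + d m k

variable {d : ℕ → ℕ → ℝ}

theorem IsMet.self (h : IsMet d) (n : ℕ) : d n n = 0 := (h.eq0 n n).2 rfl

theorem IsMet.pos (h : IsMet d) {n m : ℕ} (hn : n ≠ m) : 0 < d n m := by
  have h1 := h.tri n m n
  have h2 := h.symm n m
  have h3 := h.self n
  have h4 : d n m ≠ 0 := fun h0 => hn ((h.eq0 n m).1 h0)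
  have : 0 ≤ d n m := by linarith
  exact lt_of_le_of_ne this (Ne.symm h4)

theorem Pos.mono {S T : Set ℕ} (h : Pos d S) (hST : S ⊆ T) : Pos d T := by
  obtain ⟨C, hC, h1, h2⟩ := h
  exact ⟨C, hC.trans hST, h1, h2⟩

theorem Crowded.ball (h : IsMet d) {C : Set ℕ} (hC : Crowded d C) (i : ℕ) (ε : ℝ) :
    Crowded d (C ∩ {n | d n i < ε}) := by
  rintro a ⟨ha, hai⟩ δ hδ
  have hai' : d a i < ε := hai
  obtain ⟨n, hn, hne, hlt⟩ := hC a ha (min δ (ε - d a i)) (lt_min hδ (by linarith))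
  have h1 := lt_of_lt_of_le hlt (min_le_left _ _)
  have h2 := lt_of_lt_of_le hlt (min_le_right _ _)
  refine ⟨n, ⟨hn, ?_⟩, hne, h1⟩
  have := h.tri n a i
  show d n i < ε
  linarith

theorem Crowded.pos_ball (h : IsMet d) {C : Set ℕ} (hC : Crowded d C) {i : ℕ} (hi : i ∈ C)
    {ε : ℝ} (hε : 0 < ε) : Pos d (C ∩ {n | d n i < ε}) := by
  refine ⟨_, subset_rfl, ⟨i, hi, ?_⟩, hC.ball h i ε⟩
  show d i i < ε
  rw [h.self]; exact hε

theorem Pos.union (h : IsMet d) {S T : Set ℕ} (hST : Pos d (S ∪ T)) : Pos d S ∨ Pos d T := by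
  obtain ⟨C, hC, ⟨c, hc⟩, hcr⟩ := hST
  by_cases hcase : ∃ i ∈ C, ∃ ε > 0, ∀ n ∈ C, d n i < ε → n ∉ T
  · obtain ⟨i, hi, ε, hε, hn⟩ := hcase
    left
    refine (hcr.pos_ball h hi hε).mono ?_
    rintro n ⟨hnC, hnd⟩
    exact (hC hnC).resolve_right (hn n hnC hnd)
  · push Not at hcase
    right
    refine ⟨C ∩ T, Set.inter_subset_right, ?_, ?_⟩
    · obtain ⟨n, h1, _, h2⟩ := hcase c hc 1 one_pos
      exact ⟨n, h1, h2⟩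
    · rintro i ⟨hiC, hiT⟩ ε hε
      obtain ⟨n, hn, hne, hlt⟩ := hcr i hiC ε hε
      have hp := h.pos hne
      obtain ⟨n', h1, h2, h3⟩ := hcase n hn (min (ε - d n i) (d n i)) (lt_min (by linarith) hp)
      have h4 := lt_of_lt_of_le h2 (min_le_left _ _)
      have h5 := lt_of_lt_of_le h2 (min_le_right _ _)
      refine ⟨n', ⟨h1, h3⟩, ?_, ?_⟩
      · rintro rfl
        rw [h.symm] at h5
        exact lt_irrefl _ h5
      · have := h.tri n' n i
        linarith

/-- The filter dual to the ideal of scattered sets. -/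
def J (h : IsMet d) : Filter ℕ :=
  Filter.comk (fun S => ¬ Pos d S)
    (by rintro ⟨C, hC, ⟨c, hc⟩, _⟩; exact hC hc)
    (fun _ ht _ hst hs => ht (hs.mono hst))
    (fun _ hs _ ht hst => (hst.union h).elim hs ht)

theorem mem_J (h : IsMet d) {S : Set ℕ} : S ∈ J h ↔ ¬ Pos d Sᶜ := Iff.rfl

theorem pos_iff (h : IsMet d) {S : Set ℕ} : Pos d S ↔ ∃ᶠ n in J h, n ∈ S := by
  rw [Filter.Frequently, Filter.Eventually, mem_J, not_not]
  have : {n | n ∉ S}ᶜ = S := by ext; simp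
  rw [this]

theorem J_le_cofinite (h : IsMet d) : J h ≤ cofinite := by
  rw [le_cofinite_iff_eventually_ne]
  intro a
  rw [Filter.Eventually, mem_J]
  rintro ⟨C, hC, ⟨c, hc⟩, hcr⟩
  have e : ∀ n ∈ C, n = a := fun n hn => by simpa using hC hn
  obtain ⟨n, hn, hne, _⟩ := hcr c hc 1 one_pos
  exact hne ((e n hn).trans (e c hc).symm)

theorem exists_ultra (h : IsMet d) (E : Set ℕ) (m : ℕ)
    (hE : ∀ ε > 0, Pos d (E ∩ {n | d n m < ε})) :
    ∃ U : Ultrafilter ℕ, (U : Filter ℕ) ≤ J h ∧ E ∈ U ∧ ∀ ε > 0, ∀ᶠ n in (U : Filter ℕ), d n m < ε := by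
  let L : Filter ℕ := Filter.comk (fun S => ∃ ε > 0, ¬ Pos d (S ∩ (E ∩ {n | d n m < ε})))
    ⟨1, one_pos, by rintro ⟨C, hC, ⟨c, hc⟩, _⟩; exact (hC hc).1⟩
    (by
      rintro t ⟨ε, hε, ht⟩ s hst
      exact ⟨ε, hε, fun hs => ht (hs.mono (Set.inter_subset_inter_left _ hst))⟩)
    (by
      rintro s ⟨ε, hε, hs⟩ t ⟨δ, hδ, ht⟩
      refine ⟨min ε δ, lt_min hε hδ, fun hp => ?_⟩
      rw [Set.union_inter_distrib_right] at hp
      rcases hp.union h with h1 | h1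
      · refine hs (h1.mono ?_)
        rintro n ⟨a, b, c⟩
        have c' : d n m < min ε δ := c
        exact ⟨a, b, show d n m < _ from lt_of_lt_of_le c' (min_le_left ε δ)⟩
      · refine ht (h1.mono ?_)
        rintro n ⟨a, b, c⟩
        have c' : d n m < min ε δ := c
        exact ⟨a, b, show d n m < _ from lt_of_lt_of_le c' (min_le_right ε δ)⟩)
  have memL : ∀ S : Set ℕ, S ∈ L ↔ ∃ ε > 0, ¬ Pos d (Sᶜ ∩ (E ∩ {n | d n m < ε})) :=
    fun S => Iff.rfl
  have emp : ¬ Pos d ∅ := by rintro ⟨C, hC, ⟨c, hc⟩, _⟩; exact hC hc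
  have hne : L.NeBot := by
    rw [Filter.neBot_iff, ne_eq, ← Filter.empty_mem_iff_bot, memL]
    rintro ⟨ε, hε, hp⟩
    apply hp
    simpa using hE ε hε
  refine ⟨Ultrafilter.of L, ?_, ?_, ?_⟩
  · refine (Ultrafilter.of_le L).trans ?_
    intro S hS
    rw [mem_J] at hS
    rw [memL]
    exact ⟨1, one_pos, fun hp => hS (hp.mono Set.inter_subset_left)⟩
  · apply Ultrafilter.of_le L
    rw [memL]
    refine ⟨1, one_pos, fun hp => emp (hp.mono ?_)⟩
    rintro n ⟨a, b, c⟩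
    exact a b
  · intro ε hε
    apply Ultrafilter.of_le L
    rw [memL]
    refine ⟨ε, hε, fun hp => emp (hp.mono ?_)⟩
    rintro n ⟨a, b, c⟩
    exact a c

theorem gt_of_le_cofinite {G : Filter ℕ} (hG : G ≤ cofinite) (l : ℕ) : ∀ᶠ m in G, l < m := by
  apply hG
  rw [Nat.cofinite_eq_atTop]
  exact eventually_gt_atTop l

variable {r : ℕ → ℕ → ℕ}

/-- No `m` admits too many small predecessors. -/
theorem card_bound (hr1 : ∀ k l m : ℕ, k < l → l < m → r k m ≠ r l m) (c m : ℕ) (T : Finset ℕ)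
    (hT : ∀ l ∈ T, l < m ∧ r l m < c) : T.card ≤ c := by
  have := Finset.card_le_card_of_injOn (s := T) (t := Finset.range c) (fun l => r l m)
    (fun l hl => by simpa using (hT l hl).2)
    (by
      intro a ha b hb hab
      rcases lt_trichotomy a b with hlt | heq | hlt
      · exact absurd hab (hr1 a b m hlt (hT b hb).1)
      · exact heq
      · exact absurd hab.symm (hr1 b a m hlt (hT a ha).1))
  simpa using this

theorem bad_eq (hr2 : ∀ k l m : ℕ, k < l → l < m → r k l ≤ max (r k m) (r l m))
    (hr3 : ∀ k l m : ℕ, k < l → l < m → r k m ≤ max (r k l) (r l m))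
    {k l m : ℕ} (hkl : k < l) (hlm : l < m) (hb : ¬ r k l ≤ r l m) : r k m = r k l := by
  have h2 := hr2 k l m hkl hlm
  have h3 := hr3 k l m hkl hlm
  grind

theorem finite_bad (hr1 : ∀ k l m : ℕ, k < l → l < m → r k m ≠ r l m)
    (hr2 : ∀ k l m : ℕ, k < l → l < m → r k l ≤ max (r k m) (r l m))
    (hr3 : ∀ k l m : ℕ, k < l → l < m → r k m ≤ max (r k l) (r l m))
    (U : Ultrafilter ℕ) (hU : (U : Filter ℕ) ≤ cofinite) (k : ℕ) :
    {l | k < l ∧ ¬ ∀ᶠ m in (U : Filter ℕ), r k l ≤ r l m}.Finite := by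
  by_contra hinf
  have hinf : Set.Infinite _ := hinf
  obtain ⟨l0, hl0⟩ := hinf.nonempty
  have key : ∀ l ∈ {l | k < l ∧ ¬ ∀ᶠ m in (U : Filter ℕ), r k l ≤ r l m},
      ∀ᶠ m in (U : Filter ℕ), l < m ∧ r l m < r k l ∧ r k m = r k l := by
    rintro l ⟨hkl, hl⟩
    have hl' := Ultrafilter.eventually_not.2 hl
    filter_upwards [hl', gt_of_le_cofinite hU l] with m h1 h2
    exact ⟨h2, not_le.1 h1, bad_eq hr2 hr3 hkl h2 h1⟩
  obtain ⟨T, hT, hcard⟩ := hinf.exists_subset_card_eq (r k l0 + 1)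
  have hall : ∀ᶠ m in (U : Filter ℕ), ∀ l ∈ T, l < m ∧ r l m < r k l ∧ r k m = r k l :=
    (Filter.eventually_all_finset T).2 fun l hl => key l (hT hl)
  obtain ⟨m, h1, h2⟩ := (hall.and (key l0 hl0)).exists
  have := card_bound hr1 (r k l0) m T (fun l hl => by
    obtain ⟨a, b, c⟩ := h1 l hl
    refine ⟨a, ?_⟩
    rw [← h2.2.2, c]; exact b)
  omega

theorem shrink (F : Finset ℕ) (E : Set ℕ) (hE : Pos d E) :
    ∃ E' ⊆ E, Pos d E' ∧ ∃ c : ℕ, ∀ k ∈ F,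
      (∀ m ∈ E', r k m ≤ c) ∨ (∀ e, ¬ Pos d {m ∈ E' | r k m = e}) := by
  induction F using Finset.induction_on with
  | empty => exact ⟨E, subset_rfl, hE, 0, by simp⟩
  | insert a s ha ih =>
    obtain ⟨E', hE', hp, c, hc⟩ := ih
    by_cases hcase : ∃ e, Pos d {m ∈ E' | r a m = e}
    · obtain ⟨e, he⟩ := hcase
      refine ⟨{m ∈ E' | r a m = e}, fun m hm => hE' hm.1, he, max c e, ?_⟩
      intro k hk
      rcases Finset.mem_insert.1 hk with rfl | hk
      · left
        rintro m ⟨_, hm⟩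
        rw [hm]; exact le_max_right _ _
      · rcases hc k hk with h1 | h1
        · left
          exact fun m hm => (h1 m hm.1).trans (le_max_left _ _)
        · right
          intro e' hp'
          exact h1 e' (hp'.mono fun m hm => ⟨hm.1.1, hm.2⟩)
    · push Not at hcase
      refine ⟨E', hE', hp, c, ?_⟩
      intro k hk
      rcases Finset.mem_insert.1 hk with rfl | hk
      · exact Or.inr hcase
      · exact hc k hk

theorem exists_center (h : IsMet d) (hr1 : ∀ k l m : ℕ, k < l → l < m → r k m ≠ r l m)
    (E : Set ℕ) (hne : E.Nonempty) (hE : Crowded d E) (c : ℕ) :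
    ∃ m ∈ E, ∀ ε > 0, Pos d ({m' ∈ E | m < m' ∧ c ≤ r m m'} ∩ {n | d n m < ε}) := by
  by_contra hcon
  push Not at hcon
  have key : ∀ s : ℕ, ∃ T : Finset ℕ, T.card = s ∧ ∃ i ∈ E, ∃ ε > 0, ∀ m ∈ T,
      ¬ Pos d ({m' ∈ E | m < m' ∧ c ≤ r m m'} ∩ {n | d n i < ε}) := by
    intro s
    induction s with
    | zero =>
      obtain ⟨e, he⟩ := hne
      exact ⟨∅, rfl, e, he, 1, one_pos, by simp⟩
    | succ s ih =>
      obtain ⟨T, hT, i, hi, ε, hε, hbad⟩ := ih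
      have hp := (pos_iff h).1 (hE.pos_ball h hi hε)
      have hfin : ∀ᶠ n in J h, n ∉ T := by
        apply J_le_cofinite h
        exact T.finite_toSet.compl_mem_cofinite
      obtain ⟨m, ⟨hmE, hmi⟩, hmT⟩ := (hp.and_eventually hfin).exists
      have hmi' : d m i < ε := hmi
      obtain ⟨δ, hδ, hmbad⟩ := hcon m hmE
      refine ⟨insert m T, by rw [Finset.card_insert_of_notMem hmT, hT], m, hmE,
        min δ (ε - d m i), lt_min hδ (by linarith), ?_⟩
      intro a ha
      rcases Finset.mem_insert.1 ha with rfl | ha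
      · refine fun hq => hmbad (hq.mono ?_)
        rintro n ⟨h1, h2⟩
        have h2' : d n a < min δ (ε - d a i) := h2
        exact ⟨h1, show d n a < _ from lt_of_lt_of_le h2' (min_le_left _ _)⟩
      · refine fun hq => hbad a ha (hq.mono ?_)
        rintro n ⟨h1, h2⟩
        have h2' : d n m < min δ (ε - d m i) := h2
        have h3 := lt_of_lt_of_le h2' (min_le_right _ _)
        have := h.tri n m i
        refine ⟨h1, ?_⟩
        show d n i < ε
        linarith
  obtain ⟨T, hT, i, hi, ε, hε, hbad⟩ := key (c + 1)
  have hp := (pos_iff h).1 (hE.pos_ball h hi hε)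
  have h1 : ∀ᶠ n in J h, ∀ m ∈ T, n ∉ ({m' ∈ E | m < m' ∧ c ≤ r m m'} ∩ {n | d n i < ε}) := by
    refine (Filter.eventually_all_finset T).2 fun m hm => ?_
    have := hbad m hm
    rw [pos_iff h, Filter.not_frequently] at this
    exact this
  have h2 : ∀ᶠ n in J h, ∀ m ∈ T, m < n :=
    (Filter.eventually_all_finset T).2 fun m hm => gt_of_le_cofinite (J_le_cofinite h) m
  obtain ⟨n, ⟨hnE, hni⟩, h3, h4⟩ := (hp.and_eventually (h1.and h2)).exists
  have := card_bound hr1 c n T (fun m hm => ⟨h4 m hm, by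
    by_contra hh
    exact h3 m hm ⟨⟨hnE, h4 m hm, not_lt.1 hh⟩, hni⟩⟩)
  omega

theorem exists_new (h : IsMet d) (hr1 : ∀ k l m : ℕ, k < l → l < m → r k m ≠ r l m)
    (hr2 : ∀ k l m : ℕ, k < l → l < m → r k l ≤ max (r k m) (r l m))
    (hr3 : ∀ k l m : ℕ, k < l → l < m → r k m ≤ max (r k l) (r l m))
    (F : Finset ℕ) (E : Set ℕ) (hE : Pos d E) (hFE : ∀ k ∈ F, ∀ m ∈ E, k < m) :
    ∃ m ∈ E, ∃ U : Ultrafilter ℕ, (U : Filter ℕ) ≤ J h ∧ E ∈ U ∧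
      (∀ ε > 0, ∀ᶠ n in (U : Filter ℕ), d n m < ε) ∧
      ∀ k ∈ F, ∀ᶠ m' in (U : Filter ℕ), r k m ≤ r m m' := by
  obtain ⟨E', hE', ⟨C, hC, hCne, hCcr⟩, c, hc⟩ := shrink (r := r) F E hE
  obtain ⟨m, hm, hpos⟩ := exists_center h hr1 C hCne hCcr c
  obtain ⟨U, hUJ, hU1, hU2⟩ := exists_ultra h _ m hpos
  refine ⟨m, hE' (hC hm), U, hUJ, Filter.mem_of_superset hU1 fun n hn => hE' (hC hn.1), hU2, ?_⟩
  intro k hk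
  rcases hc k hk with h1 | h1
  · filter_upwards [hU1] with m' hm'
    exact (h1 m (hC hm)).trans hm'.2.2
  · have h2 := h1 (r k m)
    rw [pos_iff h, Filter.not_frequently] at h2
    filter_upwards [hU1, hUJ h2] with m' hm' hn
    by_contra hb
    exact hn ⟨hC hm'.1, bad_eq hr2 hr3 (hFE k hk m (hE' (hC hm))) hm'.2.1 hb⟩

/-- The invariant of the construction. -/
def Inv (h : IsMet d) (r : ℕ → ℕ → ℕ) (A : Set ℕ) (F : Finset ℕ) : Prop :=
  (∀ i ∈ F, i ∈ A) ∧
  (∀ k ∈ F, ∀ l ∈ F, ∀ m ∈ F, k < l → l < m → r k l ≤ r l m) ∧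
  ∃ U : ℕ → Ultrafilter ℕ, ∀ i ∈ F, (U i : Filter ℕ) ≤ J h ∧ A ∈ U i ∧
    (∀ ε > 0, ∀ᶠ n in (U i : Filter ℕ), d n i < ε) ∧
    ∀ k ∈ F, ∀ l ∈ F, k < l → ∀ᶠ m in (U i : Filter ℕ), r k l ≤ r l m

theorem extend (h : IsMet d) (hr1 : ∀ k l m : ℕ, k < l → l < m → r k m ≠ r l m)
    (hr2 : ∀ k l m : ℕ, k < l → l < m → r k l ≤ max (r k m) (r l m))
    (hr3 : ∀ k l m : ℕ, k < l → l < m → r k m ≤ max (r k l) (r l m))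
    (A : Set ℕ) (F : Finset ℕ) (hF : Inv h r A F) (i : ℕ) (hi : i ∈ F) (ε : ℝ) (hε : 0 < ε) :
    ∃ F' : Finset ℕ, F ⊆ F' ∧ Inv h r A F' ∧ ∃ n ∈ F', n ≠ i ∧ d n i < ε := by
  obtain ⟨hFA, hsh, U, hU⟩ := hF
  obtain ⟨hJ, hAi, hball, hgood⟩ := hU i hi
  have hcof := hJ.trans (J_le_cofinite h)
  have e1 : ∀ᶠ m in (U i : Filter ℕ), ∀ k ∈ F, k < m :=
    (Filter.eventually_all_finset F).2 fun k _ => gt_of_le_cofinite hcof k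
  have e2 : ∀ᶠ m in (U i : Filter ℕ), ∀ k ∈ F, ∀ l ∈ F, k < l → r k l ≤ r l m := by
    refine (Filter.eventually_all_finset F).2 fun k hk =>
      (Filter.eventually_all_finset F).2 fun l hl => ?_
    by_cases hkl : k < l
    · filter_upwards [hgood k hk l hl hkl] with m hm _ using hm
    · exact Filter.Eventually.of_forall fun _ hh => absurd hh hkl
  have e3 : ∀ᶠ m in (U i : Filter ℕ), ∀ k ∈ F, ∀ i' ∈ F,
      m ∉ {l | k < l ∧ ¬ ∀ᶠ m in (U i' : Filter ℕ), r k l ≤ r l m} := by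
    refine (Filter.eventually_all_finset F).2 fun k hk =>
      (Filter.eventually_all_finset F).2 fun i' hi' => ?_
    apply hcof
    exact (finite_bad hr1 hr2 hr3 (U i') ((hU i' hi').1.trans (J_le_cofinite h)) k).compl_mem_cofinite
  have hall := hball ε hε |>.and <| e1.and <| e2.and <| e3.and (Filter.eventually_mem_set.2 hAi)
  have hpos := (pos_iff h).2 (hall.frequently.filter_mono hJ)
  obtain ⟨m, ⟨m1, m2, m3, m4, m5⟩, V, hV1, hV2, hV3, hV4⟩ := exists_new h hr1 hr2 hr3 F _ hpos
    (fun k hk m hm => hm.2.1 k hk)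
  have hmF : ∀ k ∈ F, k ≠ m := fun k hk => (m2 k hk).ne
  refine ⟨insert m F, Finset.subset_insert _ _, ⟨?_, ?_, Function.update U m V, ?_⟩,
    m, Finset.mem_insert_self _ _, (hmF i hi).symm, m1⟩
  · intro a ha
    rcases Finset.mem_insert.1 ha with rfl | ha
    · exact m5
    · exact hFA a ha
  · intro k hk l hl n hn hkl hln
    rw [Finset.mem_insert] at hk hl hn
    grind
  · intro a hains
    rcases Finset.mem_insert.1 hains with rfl | ha
    · rw [Function.update_self]
      refine ⟨hV1, Filter.mem_of_superset hV2 fun n hn => hn.2.2.2.2, hV3, ?_⟩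
      intro k hk l hl hkl
      have hkF : k ∈ F := by
        rw [Finset.mem_insert] at hk hl
        grind
      rcases Finset.mem_insert.1 hl with rfl | hl
      · exact hV4 k hkF
      · filter_upwards [hV2] with n hn
        exact hn.2.2.1 k hkF l hl hkl
    · rw [Function.update_of_ne (hmF a ha)]
      obtain ⟨q1, q2, q3, q4⟩ := hU a ha
      refine ⟨q1, q2, q3, ?_⟩
      intro k hk l hl hkl
      have hkF : k ∈ F := by
        rw [Finset.mem_insert] at hk hl
        grind
      rcases Finset.mem_insert.1 hl with rfl | hl
      · by_contra hb
        exact m4 k hkF a ha ⟨hkl, hb⟩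
      · exact q4 k hkF l hl hkl

theorem extend_all (h : IsMet d) (hr1 : ∀ k l m : ℕ, k < l → l < m → r k m ≠ r l m)
    (hr2 : ∀ k l m : ℕ, k < l → l < m → r k l ≤ max (r k m) (r l m))
    (hr3 : ∀ k l m : ℕ, k < l → l < m → r k m ≤ max (r k l) (r l m))
    (A : Set ℕ) (F : Finset ℕ) (hF : Inv h r A F) (ε : ℝ) (hε : 0 < ε) :
    ∃ F' : Finset ℕ, F ⊆ F' ∧ Inv h r A F' ∧ ∀ i ∈ F, ∃ n ∈ F', n ≠ i ∧ d n i < ε := by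
  suffices H : ∀ T : Finset ℕ, T ⊆ F →
      ∃ F' : Finset ℕ, F ⊆ F' ∧ Inv h r A F' ∧ ∀ i ∈ T, ∃ n ∈ F', n ≠ i ∧ d n i < ε from
    H F subset_rfl
  intro T
  induction T using Finset.induction_on with
  | empty => exact fun _ => ⟨F, subset_rfl, hF, by simp⟩
  | insert a s ha ih =>
    intro hs
    obtain ⟨F', hFF', hI, hT⟩ := ih ((Finset.subset_insert _ _).trans hs)
    obtain ⟨F'', h1, h2, h3⟩ := extend h hr1 hr2 hr3 A F' hI a
      (hFF' (hs (Finset.mem_insert_self _ _))) ε hε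
    refine ⟨F'', hFF'.trans h1, h2, ?_⟩
    intro i hi
    rcases Finset.mem_insert.1 hi with rfl | hi
    · exact h3
    · obtain ⟨n, hn, hn'⟩ := hT i hi
      exact ⟨n, h1 hn, hn'⟩

theorem main (h : IsMet d) (hr1 : ∀ k l m : ℕ, k < l → l < m → r k m ≠ r l m)
    (hr2 : ∀ k l m : ℕ, k < l → l < m → r k l ≤ max (r k m) (r l m))
    (hr3 : ∀ k l m : ℕ, k < l → l < m → r k m ≤ max (r k l) (r l m))
    (A : Set ℕ) (hA : Pos d A) :
    ∃ B ⊆ A,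
      (∀ k ∈ B, ∀ l ∈ B, ∀ m ∈ B, k < l → l < m → r k l ≤ r l m) ∧
      B ≠ ∅ ∧
      (∀ i ∈ B, ∀ j : ℕ, ∃ n ∈ B, n ≠ i ∧ d n i < 1 / ((j : ℝ) + 1)) := by
  obtain ⟨m, hm, V, hV1, hV2, hV3, -⟩ := exists_new h hr1 hr2 hr3 ∅ A hA (by simp)
  have h0 : Inv h r A {m} := by
    refine ⟨by simpa using hm, ?_, fun _ => V, ?_⟩
    · intro k hk l hl n hn hkl
      simp only [Finset.mem_singleton] at hk hl
      omega
    · intro i hi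
      rw [Finset.mem_singleton] at hi
      subst hi
      refine ⟨hV1, hV2, hV3, ?_⟩
      intro k hk l hl hkl
      simp only [Finset.mem_singleton] at hk hl
      omega
  have hstep : ∀ (n : ℕ) (F : {F : Finset ℕ // Inv h r A F}), ∃ F' : {F : Finset ℕ // Inv h r A F},
      F.1 ⊆ F'.1 ∧ ∀ i ∈ F.1, ∃ a ∈ F'.1, a ≠ i ∧ d a i < 1 / ((n : ℝ) + 1) := by
    rintro n ⟨F, hF⟩
    obtain ⟨F', h1, h2, h3⟩ := extend_all h hr1 hr2 hr3 A F hF (1 / ((n : ℝ) + 1)) (by positivity)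
    exact ⟨⟨F', h2⟩, h1, h3⟩
  choose nx hnx1 hnx2 using hstep
  let G : ℕ → {F : Finset ℕ // Inv h r A F} := fun n => Nat.rec ⟨{m}, h0⟩ (fun n F => nx n F) n
  have hGs : ∀ n, G (n + 1) = nx n (G n) := fun n => rfl
  have hmono : Monotone fun n => (G n).1 := by
    refine monotone_nat_of_le_succ fun n => ?_
    show (G n).1 ⊆ (G (n + 1)).1
    rw [hGs]; exact hnx1 n (G n)
  refine ⟨{a | ∃ n, a ∈ (G n).1}, ?_, ?_, ?_, ?_⟩
  · rintro a ⟨n, hn⟩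
    exact (G n).2.1 a hn
  · rintro k ⟨n1, h1⟩ l ⟨n2, h2⟩ p ⟨n3, h3⟩
    refine (G (max n1 (max n2 n3))).2.2.1 k ?_ l ?_ p ?_
    · exact hmono (by simp : n1 ≤ max n1 (max n2 n3)) h1
    · exact hmono (by simp : n2 ≤ max n1 (max n2 n3)) h2
    · exact hmono (by simp : n3 ≤ max n1 (max n2 n3)) h3
  · apply Set.Nonempty.ne_empty
    exact ⟨m, 0, Finset.mem_singleton_self m⟩
  · rintro i ⟨n, hn⟩ j
    obtain ⟨a, h1, h2, h3⟩ := hnx2 (max n j) (G (max n j)) i (hmono (le_max_left n j) hn)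
    refine ⟨a, ⟨max n j + 1, h1⟩, h2, h3.trans_le ?_⟩
    apply one_div_le_one_div_of_le (by positivity)
    have : (j : ℝ) ≤ ((max n j : ℕ) : ℝ) := by exact_mod_cast le_max_right n j
    linarith

theorem pos_of_not_scattered {X : Type*} [TopologicalSpace X] (x : ℕ → X)
    (d : ℕ → ℕ → ℝ) (hd : IsCompatMetric x d) (A : Set ℕ) (hA : ¬ IsScattered x A) : Pos d A := by
  unfold IsScattered at hA
  rw [not_not] at hA
  obtain ⟨B, hBA, ⟨φ⟩⟩ := hA
  refine ⟨B, hBA, ?_, ?_⟩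
  · obtain ⟨b, hb, _⟩ := (φ.symm 0).2
    exact ⟨b, hb⟩
  · intro i hi ε hε
    obtain ⟨U, hU, hxU, hUd⟩ := hd.2.2.2.2 i ε hε
    let p : (x '' B : Set X) := ⟨x i, i, hi, rfl⟩
    have hopen : IsOpen (φ.symm ⁻¹' (Subtype.val ⁻¹' U)) :=
      (hU.preimage continuous_subtype_val).preimage φ.symm.continuous
    have hmem : φ.symm ⁻¹' (Subtype.val ⁻¹' U) ∈ nhds (φ p) :=
      hopen.mem_nhds (by simpa [p] using hxU)
    obtain ⟨q, hq, hqne⟩ : ∃ q ∈ φ.symm ⁻¹' (Subtype.val ⁻¹' U), q ≠ φ p := by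
      have := (mem_closure_iff_nhds.1 ((dense_compl_singleton (φ p)) (φ p))) _ hmem
      obtain ⟨q, h1, h2⟩ := this
      exact ⟨q, h1, h2⟩
    obtain ⟨n, hn, hnx⟩ := (φ.symm q).2
    refine ⟨n, hn, ?_, hUd n ?_⟩
    · rintro rfl
      apply hqne
      have : φ.symm q = p := Subtype.ext hnx.symm
      rw [← this, φ.apply_symm_apply]
    · rw [hnx]; exact hq

end ShiftInc

theorem stmt2
    (X : Type*) [TopologicalSpace X]
    -- a sequence of pairwise distinct points whose range is homeomorphic to ℚ
    (x : ℕ → X) (hinj : Function.Injective x)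
    (hQ : Nonempty ((Set.range x : Set X) ≃ₜ ℚ))
    -- a compatible metric on {x n : n < ω}
    (d : ℕ → ℕ → ℝ) (hd : IsCompatMetric x d)
    -- the function r and its three properties
    (r : ℕ → ℕ → ℕ)
    (hr1 : ∀ k l m : ℕ, k < l → l < m → r k m ≠ r l m)
    (hr2 : ∀ k l m : ℕ, k < l → l < m → r k l ≤ max (r k m) (r l m))
    (hr3 : ∀ k l m : ℕ, k < l → l < m → r k m ≤ max (r k l) (r l m))
    -- A ∈ I⁺
    (A : Set ℕ) (hA : ¬ IsScattered x A) :
    ∃ B ⊆ A,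
      (∀ k ∈ B, ∀ l ∈ B, ∀ m ∈ B, k < l → l < m → r k l ≤ r l m) ∧
      B ≠ ∅ ∧
      (∀ i ∈ B, ∀ j : ℕ, ∃ n ∈ B ∩ Aij d i j, n ≠ i) := by
  have hm : ShiftInc.IsMet d := ⟨hd.1, hd.2.1, hd.2.2.1⟩
  obtain ⟨B, h1, h2, h3, h4⟩ := ShiftInc.main hm hr1 hr2 hr3 A
    (ShiftInc.pos_of_not_scattered x d hd A hA)
  refine ⟨B, h1, h2, h3, fun i hi j => ?_⟩
  obtain ⟨n, hn, hne, hlt⟩ := h4 i hi j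
  exact ⟨n, ⟨hn, hlt⟩, hne⟩
end

section
/- For every A ⊆ ω, A ∈ I⁺ if and only if there exists B ⊆ A such that B ≠ ∅ and for every i ∈ B and every j < ω there exists n ∈ B ∩ A_{i,j} with n ≠ i. -/
open Set Topology

/-- A countable space coded densely in Cantor space, away from eventually constant sequences. -/
lemma core_order {Y : Type*} [TopologicalSpace Y] [Countable Y] [Nonempty Y] [T1Space Y]
    (e : Y → ℕ → Bool)
    (h1 : ∀ y n, IsOpen {z | ∀ i < n, e z i = e y i})
    (h2 : ∀ (O : Set Y), IsOpen O → ∀ y ∈ O, ∃ n, ∀ z, (∀ i < n, e z i = e y i) → z ∈ O)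
    (h3 : ∀ (s : ℕ → Bool) n, ∃ y, ∀ i < n, e y i = s i)
    (h4 : ∀ y n b, ∃ m ≥ n, e y m = b) : Nonempty (Y ≃ₜ ℚ) := by
  have hinj : Function.Injective (fun y => toLex (e y)) := by
    intro y z hyz
    have hyz' : e y = e z := hyz
    by_contra hne
    obtain ⟨n, hn⟩ := h2 {z}ᶜ isOpen_compl_singleton y hne
    exact hn z (fun i _ => by rw [hyz']) rfl
  let : LinearOrder Y := LinearOrder.lift' (fun y => toLex (e y)) hinj
  have hlt : ∀ y z : Y, y < z ↔ ∃ n, (∀ i < n, e y i = e z i) ∧ e y n = false ∧ e z n = true := by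
    intro y z
    have : y < z ↔ ∃ n, (∀ i < n, e y i = e z i) ∧ e y n < e z n := Iff.rfl
    rw [this]
    simp only [Bool.lt_iff]
  have hflip : ∀ y m, ∃ w, (∀ i < m, e w i = e y i) ∧ e w m = !(e y m) := by
    intro y m
    obtain ⟨w, hw⟩ := h3 (fun i => if i < m then e y i else !(e y i)) (m+1)
    refine ⟨w, fun i hi => ?_, ?_⟩
    · rw [hw i (by omega)]; simp [hi]
    · rw [hw m (by omega)]; simp
  have hup : ∀ y n, ∃ m ≥ n, ∃ w, (∀ i < m, e w i = e y i) ∧ e y m = false ∧ e w m = true := by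
    intro y n
    obtain ⟨m, hm, hb⟩ := h4 y n false
    obtain ⟨w, hw, hw'⟩ := hflip y m
    exact ⟨m, hm, w, hw, hb, by simp [hw', hb]⟩
  have hdn : ∀ y n, ∃ m ≥ n, ∃ w, (∀ i < m, e w i = e y i) ∧ e y m = true ∧ e w m = false := by
    intro y n
    obtain ⟨m, hm, hb⟩ := h4 y n true
    obtain ⟨w, hw, hw'⟩ := hflip y m
    exact ⟨m, hm, w, hw, hb, by simp [hw', hb]⟩
  have : DenselyOrdered Y := ⟨by
    intro y z hyz
    obtain ⟨n, hn, hy, hz⟩ := (hlt _ _).1 hyz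
    obtain ⟨m, hm, w, hw, hy', hw'⟩ := hup y (n+1)
    refine ⟨w, (hlt _ _).2 ⟨m, fun i hi => (hw i hi).symm, hy', hw'⟩, (hlt _ _).2 ⟨n, fun i hi => ?_, ?_, hz⟩⟩
    · rw [hw i (by omega), hn i hi]
    · rw [hw n (by omega), hy]⟩
  have : NoMaxOrder Y := ⟨by
    intro y
    obtain ⟨m, hm, w, hw, hy', hw'⟩ := hup y 0
    exact ⟨w, (hlt _ _).2 ⟨m, fun i hi => (hw i hi).symm, hy', hw'⟩⟩⟩
  have : NoMinOrder Y := ⟨by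
    intro y
    obtain ⟨m, hm, w, hw, hy', hw'⟩ := hdn y 0
    exact ⟨w, (hlt _ _).2 ⟨m, hw, hw', hy'⟩⟩⟩
  have : OrderTopology Y := ⟨by
    apply le_antisymm
    · apply le_generateFrom
      rintro s ⟨a, rfl | rfl⟩
      · rw [isOpen_iff_mem_nhds]
        intro y hy
        obtain ⟨n, hn, ha, hy'⟩ := (hlt _ _).1 hy
        refine Filter.mem_of_superset ((h1 y (n+1)).mem_nhds (by simp)) ?_
        intro z hz
        refine (hlt _ _).2 ⟨n, fun i hi => ?_, ha, ?_⟩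
        · rw [hz i (by omega), hn i hi]
        · rw [hz n (by omega), hy']
      · rw [isOpen_iff_mem_nhds]
        intro y hy
        obtain ⟨n, hn, ha, hy'⟩ := (hlt _ _).1 hy
        refine Filter.mem_of_superset ((h1 y (n+1)).mem_nhds (by simp)) ?_
        intro z hz
        refine (hlt _ _).2 ⟨n, fun i hi => ?_, ?_, hy'⟩
        · rw [hz i (by omega), hn i hi]
        · rw [hz n (by omega), ha]
    · intro O hO
      let t' : TopologicalSpace Y :=
        TopologicalSpace.generateFrom {s : Set Y | ∃ a, s = Ioi a ∨ s = Iio a}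
      change IsOpen[t'] O
      rw [@isOpen_iff_mem_nhds Y t' O]
      intro y hy
      obtain ⟨n, hn⟩ := h2 O hO y hy
      obtain ⟨m, hm, w, hw, hy1, hw1⟩ := hup y n
      obtain ⟨k, hk, v, hv, hy2, hv2⟩ := hdn y n
      have o1 : IsOpen[t'] (Ioi v) := TopologicalSpace.isOpen_generateFrom_of_mem ⟨v, Or.inl rfl⟩
      have o2 : IsOpen[t'] (Iio w) := TopologicalSpace.isOpen_generateFrom_of_mem ⟨w, Or.inr rfl⟩
      have hyv : y ∈ Ioi v := (hlt _ _).2 ⟨k, hv, hv2, hy2⟩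
      have hyw : y ∈ Iio w := (hlt _ _).2 ⟨m, fun i hi => (hw i hi).symm, hy1, hw1⟩
      refine Filter.mem_of_superset (Filter.inter_mem
        (@IsOpen.mem_nhds Y t' y (Ioi v) o1 hyv) (@IsOpen.mem_nhds Y t' y (Iio w) o2 hyw)) ?_
      rintro t ⟨ht1, ht2⟩
      apply hn
      obtain ⟨p, hp, hp1, hp2⟩ := (hlt _ _).1 ht1
      obtain ⟨q, hq, hq1, hq2⟩ := (hlt _ _).1 ht2
      intro i
      induction i using Nat.strong_induction_on with
      | _ i ih =>
        intro hi
        have hvi := hv i (by omega)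
        have hwi := hw i (by omega)
        rcases lt_trichotomy i p with hip | hip | hip
        · rw [← hp i hip, hvi]
        · rcases lt_trichotomy i q with hiq | hiq | hiq
          · rw [hq i hiq, hwi]
          · subst hip; subst hiq; simp_all
          · have := ih q hiq (by omega)
            rw [← hw q (by omega), hq1, hq2] at this
            cases this
        · have := ih p hip (by omega)
          rw [← hv p (by omega), hp1, hp2] at this
          cases this⟩
  obtain ⟨f⟩ := Order.iso_of_countable_dense Y ℚ
  exact ⟨f.toHomeomorph⟩

/-- Translating in Cantor space to avoid eventually constant sequences. -/
lemma core_translate {Y : Type*} [TopologicalSpace Y] [Countable Y] [Nonempty Y] [T1Space Y]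
    (e : Y → ℕ → Bool)
    (h1 : ∀ y n, IsOpen {z | ∀ i < n, e z i = e y i})
    (h2 : ∀ (O : Set Y), IsOpen O → ∀ y ∈ O, ∃ n, ∀ z, (∀ i < n, e z i = e y i) → z ∈ O)
    (h3 : ∀ (s : ℕ → Bool) n, ∃ y, ∀ i < n, e y i = s i) : Nonempty (Y ≃ₜ ℚ) := by
  -- the bad translations form a countable set
  let F : Y × List Bool × Bool → (ℕ → Bool) :=
    fun p i => xor (e p.1 i) (p.2.1.getD i p.2.2)
  have hF : ¬ Function.Surjective F := by
    intro hs
    have : Countable (ℕ → Bool) := hs.countable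
    obtain ⟨u, hu⟩ := exists_surjective_nat (ℕ → Bool)
    obtain ⟨n, hn⟩ := hu (fun i => !(u i i))
    have := congrFun hn n
    simp at this
  simp only [Function.Surjective, not_forall, not_exists] at hF
  obtain ⟨a, ha⟩ := hF
  refine core_order (fun y i => xor (e y i) (a i)) ?_ ?_ ?_ ?_
  · intro y n
    simpa using h1 y n
  · intro O hO y hy
    simpa using h2 O hO y hy
  · intro s n
    obtain ⟨y, hy⟩ := h3 (fun i => xor (s i) (a i)) n
    exact ⟨y, fun i hi => by simp [hy i hi]⟩
  · intro y n b
    by_contra hcon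
    push Not at hcon
    apply ha (y, List.ofFn (fun i : Fin n => xor (e y i) (a i)), !b)
    funext i
    simp only [F]
    by_cases hi : i < n
    · rw [List.getD_eq_getElem _ _ (by simpa using hi)]
      simp
    · rw [List.getD_eq_default _ _ (by simpa using hi)]
      have := hcon i (by omega)
      revert this
      cases e y i <;> cases a i <;> cases b <;> simp

/-- Sierpinski's theorem, for a countable clopen basis. -/
lemma sierpinski_clopen {Y : Type*} [TopologicalSpace Y] [Countable Y] [Nonempty Y] [T1Space Y]
    (U : ℕ → Set Y) (hU : ∀ n, IsClopen (U n))
    (hb : ∀ (O : Set Y), IsOpen O → ∀ y ∈ O, ∃ n, y ∈ U n ∧ U n ⊆ O)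
    (hcr : ∀ (O : Set Y), IsOpen O → ∀ y ∈ O, ∃ z ∈ O, z ≠ y) : Nonempty (Y ≃ₜ ℚ) := by
  classical
  have hsplit : ∀ (n : ℕ) (C : Set Y), ∃ V : Set Y, IsClopen C → C.Nonempty →
      IsClopen V ∧ (C ∩ V).Nonempty ∧ (C ∩ Vᶜ).Nonempty ∧
        (V = U n ∨ (∀ y ∈ C, y ∉ U n) ∨ C ⊆ U n) := by
    intro n C
    by_cases hA : (C ∩ U n).Nonempty ∧ (C ∩ (U n)ᶜ).Nonempty
    · exact ⟨U n, fun _ _ => ⟨hU n, hA.1, hA.2, Or.inl rfl⟩⟩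
    · by_cases hC : IsClopen C ∧ C.Nonempty
      · obtain ⟨hC, y, hy⟩ := hC
        obtain ⟨z, hz, hzy⟩ := hcr C hC.isOpen y hy
        obtain ⟨k, hk, hk'⟩ := hb {z}ᶜ isOpen_compl_singleton y (fun h => hzy h.symm)
        refine ⟨U k, fun _ _ => ⟨hU k, ⟨y, hy, hk⟩, ⟨z, hz, fun h => hk' h rfl⟩, Or.inr ?_⟩⟩
        by_contra hcon
        push Not at hcon
        obtain ⟨⟨p, hp, hp'⟩, hq⟩ := hcon
        obtain ⟨q, hq, hq'⟩ := Set.not_subset.1 hq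
        exact hA ⟨⟨p, hp, hp'⟩, ⟨q, hq, hq'⟩⟩
      · exact ⟨∅, fun a b => absurd ⟨a, b⟩ hC⟩
  choose S hS using hsplit
  let C : List Bool → Set Y := fun l => List.rec (motive := fun _ => Set Y) Set.univ
    (fun b s ih => ih ∩ (if b then S s.length ih else (S s.length ih)ᶜ)) l
  have C0 : C [] = Set.univ := rfl
  have C1 : ∀ b s, C (b :: s) = C s ∩ (if b then S s.length (C s) else (S s.length (C s))ᶜ) :=
    fun _ _ => rfl
  have hC : ∀ l, IsClopen (C l) ∧ (C l).Nonempty := by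
    intro l
    induction l with
    | nil => rw [C0]; exact ⟨isClopen_univ, Set.univ_nonempty⟩
    | cons b s ih =>
      obtain ⟨a1, a2, a3, -⟩ := hS s.length (C s) ih.1 ih.2
      rw [C1]
      cases b
      · simpa using ⟨ih.1.inter a1.compl, a3⟩
      · simpa using ⟨ih.1.inter a1, a2⟩
  let P : Y → ℕ → List Bool := fun y n => Nat.rec (motive := fun _ => List Bool) []
    (fun n l => decide (y ∈ S n (C l)) :: l) n
  have P0 : ∀ y, P y 0 = [] := fun _ => rfl
  have P1 : ∀ y n, P y (n+1) = decide (y ∈ S n (C (P y n))) :: P y n := fun _ _ => rfl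
  have Plen : ∀ y n, (P y n).length = n := by
    intro y n
    induction n with
    | zero => rfl
    | succ n ih => rw [P1]; simp [ih]
  have Pmem : ∀ y n, y ∈ C (P y n) := by
    intro y n
    induction n with
    | zero => rw [P0, C0]; trivial
    | succ n ih =>
      rw [P1, C1, Plen]
      refine ⟨ih, ?_⟩
      by_cases h : y ∈ S n (C (P y n)) <;> simp [h]
  have Puniq : ∀ l y, y ∈ C l → P y l.length = l := by
    intro l y
    induction l with
    | nil => intro _; rfl
    | cons b s ih =>
      intro hy
      rw [C1] at hy
      have h := ih hy.1
      rw [List.length_cons, P1, h]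
      have h2 := hy.2
      cases b <;> simp_all
  let e : Y → ℕ → Bool := fun y n => decide (y ∈ S n (C (P y n)))
  have P1' : ∀ y n, P y (n+1) = e y n :: P y n := fun _ _ => rfl
  have heP : ∀ y z n, (∀ i < n, e z i = e y i) ↔ P z n = P y n := by
    intro y z n
    induction n with
    | zero => simp [P0]
    | succ n ih =>
      rw [P1', P1', List.cons.injEq, ← ih]
      constructor
      · intro h; exact ⟨h n (by omega), fun i hi => h i (by omega)⟩
      · rintro ⟨h, h'⟩ i hi
        rcases Nat.lt_succ_iff_lt_or_eq.1 hi with h'' | rfl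
        · exact h' i h''
        · exact h
  have heC : ∀ y z n, (∀ i < n, e z i = e y i) ↔ z ∈ C (P y n) := by
    intro y z n
    rw [heP]
    constructor
    · intro h; rw [← h]; exact Pmem z n
    · intro h
      have := Puniq _ _ h
      rwa [Plen] at this
  refine core_translate e ?_ ?_ ?_
  · intro y n
    simp only [heC]
    exact (hC _).1.isOpen
  · intro O hO y hy
    obtain ⟨n, hn, hn'⟩ := hb O hO y hy
    refine ⟨n+1, fun z hz => hn' ?_⟩
    have hz1 : z ∈ C (P y n) := (heC y z n).1 (fun i hi => hz i (by omega))
    have hPz : P z n = P y n := (heP y z n).1 (fun i hi => hz i (by omega))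
    have hzn := hz n (by omega)
    obtain ⟨-, -, -, h | h | h⟩ := hS n (C (P y n)) (hC _).1 (hC _).2
    · simp only [e, hPz, h] at hzn
      simpa [hn] using hzn
    · exact absurd hn (h y (Pmem y n))
    · exact h hz1
  · intro s n
    let L : ℕ → List Bool := fun n => Nat.rec (motive := fun _ => List Bool) []
      (fun n l => s n :: l) n
    have L1 : ∀ n, L (n+1) = s n :: L n := fun _ => rfl
    have Llen : ∀ n, (L n).length = n := by
      intro n
      induction n with
      | zero => rfl
      | succ n ih => rw [L1]; simp [ih]
    obtain ⟨y, hy⟩ := (hC (L n)).2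
    have hP := Puniq _ _ hy
    rw [Llen] at hP
    refine ⟨y, ?_⟩
    clear hy
    induction n with
    | zero => intro i hi; omega
    | succ n ih =>
      rw [P1', L1, List.cons.injEq] at hP
      intro i hi
      rcases Nat.lt_succ_iff_lt_or_eq.1 hi with h'' | rfl
      · exact ih hP.2 i h''
      · exact hP.1

lemma clopen_rat (r : ℚ) (k : ℕ) :
    IsClopen {q : ℚ | |(q : ℝ) - r| < √2 / ((k : ℝ) + 1)} := by
  have hc : Continuous (fun q : ℚ => |(q : ℝ) - r|) :=
    (Rat.continuous_coe_real.sub continuous_const).abs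
  refine ⟨?_, isOpen_lt hc continuous_const⟩
  have : {q : ℚ | |(q : ℝ) - r| < √2 / ((k : ℝ) + 1)}
      = {q : ℚ | |(q : ℝ) - r| ≤ √2 / ((k : ℝ) + 1)} := by
    ext q
    simp only [Set.mem_ofPred_eq]
    refine ⟨fun h => le_of_lt h, fun h => lt_of_le_of_ne h ?_⟩
    intro heq
    have hk : ((k : ℝ) + 1) ≠ 0 := by positivity
    rw [eq_div_iff hk] at heq
    apply irrational_sqrt_two
    exact ⟨|q - r| * ((k : ℚ) + 1), by push_cast; exact heq⟩
  rw [this]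
  exact isClosed_le hc continuous_const

lemma sierpinski_rat {Y : Type*} [TopologicalSpace Y] [Nonempty Y]
    (f : Y → ℚ) (hf : IsEmbedding f)
    (hcr : ∀ (O : Set Y), IsOpen O → ∀ y ∈ O, ∃ z ∈ O, z ≠ y) : Nonempty (Y ≃ₜ ℚ) := by
  have : Countable Y := hf.injective.countable
  have : T1Space Y := hf.t1Space
  obtain ⟨g, hg⟩ := exists_surjective_nat (ℚ × ℕ)
  refine sierpinski_clopen
    (fun n => f ⁻¹' {q : ℚ | |(q : ℝ) - (g n).1| < √2 / (((g n).2 : ℝ) + 1)})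
    (fun n => (clopen_rat _ _).preimage hf.continuous) ?_ hcr
  intro O hO y hy
  obtain ⟨W, hW, rfl⟩ := hf.isOpen_iff.1 hO
  obtain ⟨ε, hε, hball⟩ := Metric.isOpen_iff.1 hW (f y) hy
  obtain ⟨k, hk⟩ := exists_nat_one_div_lt (show (0:ℝ) < ε / √2 by positivity)
  obtain ⟨n, hn⟩ := hg (f y, k)
  refine ⟨n, ?_, ?_⟩
  · simp only [hn, mem_preimage, mem_ofPred_eq, sub_self, abs_zero]
    positivity
  · intro z hz
    simp only [hn, mem_preimage, mem_ofPred_eq] at hz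
    apply hball
    rw [Metric.mem_ball, Rat.dist_eq]
    refine hz.trans ?_
    have h2 : (0:ℝ) < √2 := by positivity
    rw [lt_div_iff₀ h2] at hk
    calc √2 / ((k:ℝ)+1) = 1 / ((k:ℝ)+1) * √2 := by ring
      _ < ε := hk

theorem stmt4
    (X : Type*) [TopologicalSpace X]
    (x : ℕ → X) (hinj : Function.Injective x)
    (hQ : Nonempty ((Set.range x : Set X) ≃ₜ ℚ))
    (d : ℕ → ℕ → ℝ) (hd : IsCompatMetric x d)
    (A : Set ℕ) :
    ¬ IsScattered x A ↔
      ∃ B ⊆ A, B ≠ ∅ ∧ ∀ i ∈ B, ∀ j : ℕ, ∃ n ∈ B ∩ Aij d i j, n ≠ i := by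
  obtain ⟨-, -, -, hd1, hd2⟩ := hd
  unfold IsScattered
  rw [not_not]
  constructor
  · rintro ⟨B, hBA, ⟨h⟩⟩
    refine ⟨B, hBA, ?_, ?_⟩
    · rintro rfl
      have := (h.symm 0).2
      simp at this
    · intro i hi j
      obtain ⟨U, hU, hiU, hU'⟩ := hd2 i (1 / ((j:ℝ)+1)) (by positivity)
      let p : (x '' B : Set X) := ⟨x i, i, hi, rfl⟩
      have hO : IsOpen (h.symm ⁻¹' (Subtype.val ⁻¹' U)) :=
        (hU.preimage continuous_subtype_val).preimage h.symm.continuous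
      have hp : h p ∈ h.symm ⁻¹' (Subtype.val ⁻¹' U) := by simpa [p] using hiU
      obtain ⟨q, hq, hne⟩ : ∃ q ∈ h.symm ⁻¹' (Subtype.val ⁻¹' U), q ≠ h p := by
        obtain ⟨q, hq1, hq2⟩ := Filter.nonempty_of_mem (Filter.inter_mem
          (mem_nhdsWithin_of_mem_nhds (hO.mem_nhds hp))
          (self_mem_nhdsWithin : {h p}ᶜ ∈ 𝓝[≠] (h p)))
        exact ⟨q, hq1, hq2⟩
      obtain ⟨n, hn, hnq⟩ := (h.symm q).2
      refine ⟨n, ⟨hn, hU' n ?_⟩, ?_⟩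
      · rw [hnq]; exact hq
      · rintro rfl
        apply hne
        rw [← h.apply_symm_apply q]
        congr 1
        exact Subtype.ext hnq.symm
  · rintro ⟨B, hBA, hne, hB⟩
    refine ⟨B, hBA, ?_⟩
    obtain ⟨h⟩ := hQ
    obtain ⟨b, hb⟩ := Set.nonempty_iff_ne_empty.2 hne
    have : Nonempty (x '' B : Set X) := ⟨⟨x b, b, hb, rfl⟩⟩
    have hsub : (x '' B : Set X) ⊆ Set.range x := Set.image_subset_range x B
    refine sierpinski_rat (h ∘ Set.inclusion hsub)
      (h.isEmbedding.comp (IsEmbedding.inclusion hsub)) ?_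
    rintro O hO ⟨_, i, hi, rfl⟩ hy
    obtain ⟨U, hU, rfl⟩ := isOpen_induced_iff.1 hO
    obtain ⟨ε, hε, hεU⟩ := hd1 i U hU hy
    obtain ⟨j, hj⟩ := exists_nat_one_div_lt hε
    obtain ⟨n, ⟨hn, hnA⟩, hni⟩ := hB i hi j
    refine ⟨⟨x n, n, hn, rfl⟩, hεU n (lt_trans hnA hj), ?_⟩
    intro heq
    exact hni (hinj (Subtype.ext_iff.1 heq))
end

section
/- For every A ∈ I⁺ there exists B ⊆ A such that B ∈ I⁺ and for every i ∈ B and every j < ω, B ∩ A_{i,j} ∈ I⁺. -/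
theorem stmt5
    (X : Type*) [TopologicalSpace X]
    (x : ℕ → X) (hinj : Function.Injective x)
    (hQ : Nonempty ((Set.range x : Set X) ≃ₜ ℚ))
    (d : ℕ → ℕ → ℝ) (hd : IsCompatMetric x d)
    (A : Set ℕ) (hA : ¬ IsScattered x A) :
    ∃ B ⊆ A, ¬ IsScattered x B ∧
      ∀ i ∈ B, ∀ j : ℕ, ¬ IsScattered x (B ∩ Aij d i j) := by
  classical
  obtain ⟨B, hBA, ⟨h⟩⟩ := not_not.mp hA
  refine ⟨B, hBA, not_not.mpr ⟨B, subset_rfl, ⟨h⟩⟩, ?_⟩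
  intro i hi j
  obtain ⟨U, hUo, hiU, hU⟩ := hd.2.2.2.2 i (1 / ((j : ℝ) + 1)) (by positivity)
  let ψ : ℚ → X := fun q => (h.symm q : X)
  have hψ : Topology.IsEmbedding ψ := Topology.IsEmbedding.subtypeVal.comp h.symm.isEmbedding
  let q : ℚ := h ⟨x i, i, hi, rfl⟩
  have hq : ψ q = x i := by simp [ψ, q]
  have hmem : ψ ⁻¹' U ∈ nhds q :=
    (hUo.preimage hψ.continuous).mem_nhds (by simpa [hq] using hiU)
  obtain ⟨a, b, hab, hsub⟩ := mem_nhds_iff_exists_Ioo_subset.mp hmem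
  have hne : a < b := hab.1.trans hab.2
  haveI : Nonempty (Set.Ioo a b) := ⟨⟨q, hab⟩⟩
  obtain ⟨e⟩ := Order.iso_of_countable_dense (Set.Ioo a b) ℚ
  let f : Set.Ioo a b → X := fun r => ψ r
  have hf : Topology.IsEmbedding f := hψ.comp Topology.IsEmbedding.subtypeVal
  refine not_not.mpr ⟨{n | n ∈ B ∧ x n ∈ Set.range f}, ?_, ?_⟩
  · rintro n ⟨hnB, r, hr⟩
    refine ⟨hnB, hU n ?_⟩
    rw [← hr]
    exact hsub r.2
  · have hrange : x '' {n | n ∈ B ∧ x n ∈ Set.range f} = Set.range f := by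
      ext y
      constructor
      · rintro ⟨n, ⟨_, hn⟩, rfl⟩
        exact hn
      · rintro ⟨r, rfl⟩
        obtain ⟨n, hn, hnr⟩ := (h.symm (r : ℚ)).2
        exact ⟨n, ⟨hn, r, hnr.symm⟩, hnr⟩
    exact ⟨(Homeomorph.setCongr hrange).trans (hf.toHomeomorph.symm.trans e.toHomeomorph)⟩
end

section
/- Let U be an ultrafilter on ω with U ⊆ I⁺. Then for every C ∈ U there exists I₀ ∈ I such that for every i ∈ C \ I₀ and every w < ω, (C \ I₀) ∩ A_{i,w} ∈ I⁺. -/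
theorem notScattered_of_embedding {X : Type*} [TopologicalSpace X] (x : ℕ → X) (A : Set ℕ)
    (e : ℚ → X) (he : Topology.IsEmbedding e) (hr : Set.range e ⊆ x '' A) :
    ¬ IsScattered x A := by
  intro h
  apply h
  refine ⟨A ∩ x ⁻¹' Set.range e, Set.inter_subset_left, ?_⟩
  have : x '' (A ∩ x ⁻¹' Set.range e) = Set.range e := by
    rw [Set.image_inter_preimage]
    exact Set.inter_eq_right.mpr hr
  rw [this]
  exact ⟨he.toHomeomorph.symm⟩

theorem embedding_Ioo (a b : ℚ) (hab : a < b) :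
    ∃ g : ℚ → ℚ, Topology.IsEmbedding g ∧ Set.range g ⊆ Set.Ioo a b := by
  haveI : Nonempty (Set.Ioo a b) := (Set.nonempty_Ioo.mpr hab).to_subtype
  obtain ⟨f⟩ := Order.iso_of_countable_dense ℚ (Set.Ioo a b)
  refine ⟨fun q => (f q : ℚ), Topology.IsEmbedding.subtypeVal.comp
    f.toHomeomorph.isEmbedding, ?_⟩
  rintro _ ⟨q, rfl⟩
  exact (f q).2

theorem stmt6
    (X : Type*) [TopologicalSpace X]
    (x : ℕ → X) (hinj : Function.Injective x)
    (hQ : Nonempty ((Set.range x : Set X) ≃ₜ ℚ))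
    (d : ℕ → ℕ → ℝ) (hd : IsCompatMetric x d)
    -- U is an ultrafilter on ω with U ⊆ I⁺
    (U : Ultrafilter ℕ) (hU : ∀ S ∈ U, ¬ IsScattered x S)
    (C : Set ℕ) (hC : C ∈ U) :
    ∃ I₀ : Set ℕ, IsScattered x I₀ ∧
      ∀ i ∈ C \ I₀, ∀ w : ℕ, ¬ IsScattered x ((C \ I₀) ∩ Aij d i w) := by
  refine ⟨C \ {n | ∃ B ⊆ C, Nonempty ((x '' B : Set X) ≃ₜ ℚ) ∧ n ∈ B}, ?_, ?_⟩
  · rintro ⟨B, hB, ⟨h⟩⟩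
    obtain ⟨n, hn, -⟩ := (h.symm 0).2
    exact (hB hn).2 ⟨B, fun m hm => (hB hm).1, ⟨h⟩, hn⟩
  · rintro i ⟨hiC, hi⟩ w
    have hi' : ∃ B ⊆ C, Nonempty ((x '' B : Set X) ≃ₜ ℚ) ∧ i ∈ B := by
      by_contra hcon
      exact hi ⟨hiC, hcon⟩
    obtain ⟨B, hBC, ⟨h⟩, hiB⟩ := hi'
    obtain ⟨V, hV, hiV, hVd⟩ := hd.2.2.2.2 i (1 / ((w : ℝ) + 1)) (by positivity)
    have hf : Topology.IsEmbedding (fun q => (h.symm q : X)) :=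
      Topology.IsEmbedding.subtypeVal.comp h.symm.isEmbedding
    have hopen : IsOpen ((fun q => (h.symm q : X)) ⁻¹' V) := hV.preimage hf.continuous
    have hq : h ⟨x i, i, hiB, rfl⟩ ∈ (fun q => (h.symm q : X)) ⁻¹' V := by
      simpa using hiV
    obtain ⟨a, b, hab, hsub⟩ := mem_nhds_iff_exists_Ioo_subset.mp (hopen.mem_nhds hq)
    obtain ⟨g, hg, hgr⟩ := embedding_Ioo a b (hab.1.trans hab.2)
    refine notScattered_of_embedding x _ _ (hf.comp hg) ?_
    rintro _ ⟨q, rfl⟩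
    have hqV : (h.symm (g q) : X) ∈ V := hsub (hgr ⟨q, rfl⟩)
    obtain ⟨n, hn, hnx⟩ := (h.symm (g q)).2
    refine ⟨n, ⟨⟨hBC hn, fun hc => hc.2 ⟨B, hBC, ⟨h⟩, hn⟩⟩, ?_⟩, hnx⟩
    exact hVd n (by rw [hnx]; exact hqV)
end

section
/- Let U be an ultrafilter on ω with U ⊆ I⁺, let D ⊆ ω, let E ∈ U with E ⊆ D, and let k < ω. For each i ∈ E with k < i define F_i = {m ∈ D : i < m and r(k,m) < r(i,m)}. Then the set G = {i ∈ E : k < i and for every w < ω, E ∩ F_i ∩ A_{i,w} ∈ I⁺} belongs to U. -/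
open Topology in
lemma subQ (S : Set ℚ) (hne : S.Nonempty)
    (h1 : ∀ s ∈ S, ∀ y < s, ∃ t ∈ S, y < t ∧ t < s)
    (h2 : ∀ s ∈ S, ∀ y > s, ∃ t ∈ S, s < t ∧ t < y) :
    ∃ g : ℚ → ℚ, IsEmbedding g ∧ ∀ q, g q ∈ S := by
  have : Nonempty S := hne.to_subtype
  have : DenselyOrdered S := ⟨fun a b hab => by
    obtain ⟨t, ht, h, h'⟩ := h1 b b.2 a hab
    exact ⟨⟨t, ht⟩, h, h'⟩⟩
  have : NoMinOrder S := ⟨fun a => by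
    obtain ⟨t, ht, h, h'⟩ := h1 a a.2 (a - 1) (by linarith)
    exact ⟨⟨t, ht⟩, h'⟩⟩
  have : NoMaxOrder S := ⟨fun a => by
    obtain ⟨t, ht, h, h'⟩ := h2 a a.2 (a + 1) (by linarith)
    exact ⟨⟨t, ht⟩, h⟩⟩
  have : OrderTopology S := by
    refine induced_orderTopology' (Subtype.val : S → ℚ) Iff.rfl ?_ ?_
    · intro a y h
      obtain ⟨t, ht, h, h'⟩ := h1 a a.2 y h
      exact ⟨⟨t, ht⟩, h', h.le⟩
    · intro a y h
      obtain ⟨t, ht, h, h'⟩ := h2 a a.2 y h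
      exact ⟨⟨t, ht⟩, h, h'.le⟩
  obtain ⟨e⟩ := Order.iso_of_countable_dense ℚ S
  exact ⟨fun q => (e q : ℚ), IsEmbedding.subtypeVal.comp e.toHomeomorph.isEmbedding,
    fun q => (e q).2⟩

open Topology in
lemma subQ_Ioo (a b : ℚ) (hab : a < b) :
    ∃ g : ℚ → ℚ, IsEmbedding g ∧ ∀ q, g q ∈ Set.Ioo a b := by
  refine subQ _ (Set.nonempty_Ioo.2 hab) ?_ ?_
  · intro s hs y hy
    obtain ⟨t, ht, ht'⟩ := exists_between (max_lt hy hs.1)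
    rw [max_lt_iff] at ht
    exact ⟨t, ⟨ht.2, ht'.trans hs.2⟩, ht.1, ht'⟩
  · intro s hs y hy
    obtain ⟨t, ht, ht'⟩ := exists_between (lt_min hy hs.2)
    rw [lt_min_iff] at ht'
    exact ⟨t, ⟨hs.1.trans ht, ht'.2⟩, ht, ht'.1⟩

open Topology in
lemma not_scattered_iff {X : Type*} [TopologicalSpace X] (x : ℕ → X) (A : Set ℕ) :
    ¬ IsScattered x A ↔ ∃ f : ℚ → ℕ, IsEmbedding (x ∘ f) ∧ ∀ q, f q ∈ A := by
  unfold IsScattered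
  rw [not_not]
  constructor
  · rintro ⟨B, hB, ⟨e⟩⟩
    have : ∀ q, ∃ n ∈ B, x n = (e.symm q : X) := fun q => (e.symm q).2
    choose f hf hfx using this
    refine ⟨f, ?_, fun q => hB (hf q)⟩
    have h : x ∘ f = fun q => (e.symm q : X) := funext hfx
    rw [h]
    exact IsEmbedding.subtypeVal.comp e.symm.isEmbedding
  · rintro ⟨f, hf, hA⟩
    refine ⟨Set.range f, by rintro _ ⟨q, rfl⟩; exact hA q, ?_⟩
    rw [← Set.range_comp]
    exact ⟨hf.toHomeomorph.symm⟩

lemma not_scattered_mono {X : Type*} [TopologicalSpace X] {x : ℕ → X} {A B : Set ℕ}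
    (hA : ¬ IsScattered x A) (h : A ⊆ B) : ¬ IsScattered x B := by
  rw [not_scattered_iff] at *
  obtain ⟨f, hf, hA⟩ := hA
  exact ⟨f, hf, fun q => h (hA q)⟩

lemma not_scattered_diff {X : Type*} [TopologicalSpace X] {x : ℕ → X} {A B : Set ℕ}
    (hA : ¬ IsScattered x A) (hB : IsScattered x B) : ¬ IsScattered x (A \ B) := by
  by_contra hAB
  revert hB
  rw [imp_false]
  have hAB' : ¬ ∃ f : ℚ → ℕ, Topology.IsEmbedding (x ∘ f) ∧ ∀ q, f q ∈ A \ B := by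
    rw [← not_scattered_iff]; exact not_not.2 hAB
  rw [not_scattered_iff] at *
  obtain ⟨f, hf, hA⟩ := hA
  by_cases hd : ∀ a b : ℚ, a < b → ∃ t, f t ∈ B ∧ a < t ∧ t < b
  · obtain ⟨g, hg, hgS⟩ := subQ (f ⁻¹' B) (by
      obtain ⟨t, ht, _⟩ := hd 0 1 one_pos
      exact ⟨t, ht⟩) (fun s _ y hy => hd y s hy) (fun s _ y hy => hd s y hy)
    exact ⟨f ∘ g, hf.comp hg, hgS⟩
  · push Not at hd
    obtain ⟨a, b, hab, h⟩ := hd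
    obtain ⟨g, hg, hgS⟩ := subQ_Ioo a b hab
    exact absurd ⟨f ∘ g, hf.comp hg, fun q => ⟨hA _, fun hB =>
      absurd (hgS q).2 (not_lt.2 (h _ hB (hgS q).1))⟩⟩ hAB'

lemma scattered_finite {X : Type*} [TopologicalSpace X] (x : ℕ → X) {A : Set ℕ}
    (hA : A.Finite) : IsScattered x A := by
  by_contra h
  rw [not_scattered_iff] at h
  obtain ⟨f, hf, h⟩ := h
  have hi : Function.Injective f := hf.injective.of_comp
  exact Set.infinite_range_of_injective hi (hA.subset (by rintro _ ⟨q, rfl⟩; exact h q))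

lemma exists_local {X : Type*} [TopologicalSpace X] {x : ℕ → X} {d : ℕ → ℕ → ℝ}
    (hd : IsCompatMetric x d) {S : Set ℕ} (hS : ¬ IsScattered x S) :
    ∃ i ∈ S, ∀ w, ¬ IsScattered x (S ∩ Aij d i w) := by
  have hS' := hS
  rw [not_scattered_iff] at hS'
  obtain ⟨f, hf, h⟩ := hS'
  refine ⟨f 0, h 0, fun w => ?_⟩
  rw [not_scattered_iff]
  obtain ⟨V, hV, h0, hVd⟩ := hd.2.2.2.2 (f 0) (1 / ((w : ℝ) + 1)) (by positivity)
  have hn : (x ∘ f) ⁻¹' V ∈ nhds (0 : ℚ) := (hV.preimage hf.continuous).mem_nhds h0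
  obtain ⟨a, b, hab, hs⟩ := mem_nhds_iff_exists_Ioo_subset.1 hn
  obtain ⟨g, hg, hgS⟩ := subQ_Ioo a b (hab.1.trans hab.2)
  exact ⟨f ∘ g, hf.comp hg, fun q => ⟨h _, hVd _ (hs (hgS q))⟩⟩

theorem stmt7
    (X : Type*) [TopologicalSpace X]
    (x : ℕ → X) (hinj : Function.Injective x)
    (hQ : Nonempty ((Set.range x : Set X) ≃ₜ ℚ))
    (d : ℕ → ℕ → ℝ) (hd : IsCompatMetric x d)
    -- the function r and its three properties
    (r : ℕ → ℕ → ℕ)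
    (hr1 : ∀ k l m : ℕ, k < l → l < m → r k m ≠ r l m)
    (hr2 : ∀ k l m : ℕ, k < l → l < m → r k l ≤ max (r k m) (r l m))
    (hr3 : ∀ k l m : ℕ, k < l → l < m → r k m ≤ max (r k l) (r l m))
    -- U is an ultrafilter on ω with U ⊆ I⁺
    (U : Ultrafilter ℕ) (hU : ∀ S ∈ U, ¬ IsScattered x S)
    (D : Set ℕ) (E : Set ℕ) (hE : E ∈ U) (hED : E ⊆ D) (k : ℕ)
    -- F i = {m ∈ D : i < m and r(k,m) < r(i,m)}
    (F : ℕ → Set ℕ)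
    (hF : ∀ i, F i = {m | m ∈ D ∧ i < m ∧ r k m < r i m}) :
    {i | i ∈ E ∧ k < i ∧ ∀ w : ℕ, ¬ IsScattered x (E ∩ F i ∩ Aij d i w)} ∈ U := by
  by_contra hG
  rw [← Ultrafilter.compl_mem_iff_notMem] at hG
  set H : Set ℕ := {i | i ∈ E ∧ k < i ∧ ∃ w : ℕ, IsScattered x (E ∩ F i ∩ Aij d i w)} with hH
  have hHs : ¬ IsScattered x H := by
    have h1 := not_scattered_diff (hU _ (Filter.inter_mem hE hG))
      (scattered_finite x (Set.finite_Iic k))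
    refine not_scattered_mono h1 ?_
    rintro i ⟨⟨hiE, hi⟩, hik⟩
    have hik' : k < i := by simpa using hik
    refine ⟨hiE, hik', ?_⟩
    by_contra hc
    push Not at hc
    exact hi ⟨hiE, hik', hc⟩
  have step : ∀ T ⊆ H, ¬ IsScattered x T → ∃ i ∈ T, ∃ T' ⊆ T, ¬ IsScattered x T' ∧
      ∀ m ∈ T', i < m ∧ r i m < r k m ∧ r k m = r k i := by
    intro T hTH hT
    obtain ⟨i, hiT, hi⟩ := exists_local hd hT
    obtain ⟨hiE, hki, w, hw⟩ := hTH hiT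
    refine ⟨i, hiT, _, ?_, not_scattered_diff (not_scattered_diff (hi w) hw)
      (scattered_finite x (Set.finite_Iic i)), ?_⟩
    · rintro m ⟨⟨⟨hm, _⟩, _⟩, _⟩
      exact hm
    · rintro m ⟨⟨⟨hm, hmA⟩, hmF⟩, hmi⟩
      have him : i < m := by simpa using hmi
      have hmE := (hTH hm).1
      have hlt : r i m < r k m := by
        by_contra hc
        have hne := hr1 k i m hki him
        refine hmF ⟨⟨hmE, ?_⟩, hmA⟩
        rw [hF]
        exact ⟨hED hmE, him, by omega⟩
      have a2 := hr2 k i m hki him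
      have a3 := hr3 k i m hki him
      exact ⟨him, hlt, by omega⟩
  obtain ⟨i0, _, T0, hT0H, hT0, hc⟩ := step H subset_rfl hHs
  have ind : ∀ n : ℕ, ∃ s : Finset ℕ, s.card = n ∧ ∃ T ⊆ T0, ¬ IsScattered x T ∧
      ∀ m ∈ T, ∀ i ∈ s, i < m ∧ r i m < r k i0 := by
    intro n
    induction n with
    | zero => exact ⟨∅, rfl, T0, subset_rfl, hT0, by simp⟩
    | succ n ih =>
      obtain ⟨s, hs, T, hTT, hT, h⟩ := ih
      obtain ⟨i, hi, T', hT', hTs, h'⟩ := step T (hTT.trans hT0H) hT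
      refine ⟨insert i s, ?_, T', hT'.trans hTT, hTs, ?_⟩
      · rw [Finset.card_insert_of_notMem, hs]
        intro his
        exact lt_irrefl _ (h i hi i his).1
      · intro m hm j hj
        rcases Finset.mem_insert.1 hj with rfl | hj
        · have := h' m hm
          have := hc m (hTT (hT' hm))
          omega
        · exact h m (hT' hm) j hj
  obtain ⟨s, hs, T, _, hT, h⟩ := ind (r k i0 + 1)
  obtain ⟨m, hm, _⟩ := exists_local hd hT
  have hinjs : Set.InjOn (fun i => r i m) s := by
    intro a ha b hb hab
    have h1 := (h m hm a ha).1
    have h2 := (h m hm b hb).1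
    rcases lt_trichotomy a b with hl | hl | hl
    · exact absurd hab (hr1 a b m hl h2)
    · exact hl
    · exact absurd hab.symm (hr1 b a m hl h1)
  have := Finset.card_le_card_of_injOn (t := Finset.range (r k i0)) (fun i => r i m)
    (fun i hi => by simpa using (h m hm i hi).2) hinjs
  rw [hs, Finset.card_range] at this
  omega
end

section
/- Let U and V be nonprincipal ultrafilters on ω, let D ∈ V, let E ∈ U with E ⊆ D, and let k < ω. For each i ∈ E with k < i define F_i = {m ∈ D : i < m and r(k,m) < r(i,m)}. Then the set H = {i ∈ E : k < i and F_i ∈ V} belongs to U. -/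
theorem stmt8
    -- the function r and its three properties
    (r : ℕ → ℕ → ℕ)
    (hr1 : ∀ k l m : ℕ, k < l → l < m → r k m ≠ r l m)
    (hr2 : ∀ k l m : ℕ, k < l → l < m → r k l ≤ max (r k m) (r l m))
    (hr3 : ∀ k l m : ℕ, k < l → l < m → r k m ≤ max (r k l) (r l m))
    -- U and V are nonprincipal ultrafilters on ω
    (U V : Ultrafilter ℕ)
    (hU : ∀ S : Set ℕ, S.Finite → S ∉ U)
    (hV : ∀ S : Set ℕ, S.Finite → S ∉ V)
    (D : Set ℕ) (hD : D ∈ V)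
    (E : Set ℕ) (hE : E ∈ U) (hED : E ⊆ D) (k : ℕ)
    -- F i = {m ∈ D : i < m and r(k,m) < r(i,m)}
    (F : ℕ → Set ℕ)
    (hF : ∀ i, F i = {m | m ∈ D ∧ i < m ∧ r k m < r i m}) :
    {i | i ∈ E ∧ k < i ∧ F i ∈ V} ∈ U := by
  by_contra hH
  have hB : E ∩ {i | i ∈ E ∧ k < i ∧ F i ∈ V}ᶜ ∈ U :=
    Filter.inter_mem hE (Ultrafilter.compl_mem_iff_notMem.mpr hH)
  have hgt : {i | k < i} ∈ U := by
    have h1 := Ultrafilter.compl_mem_iff_notMem.mpr (hU (Set.Iic k) (Set.finite_Iic k))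
    exact Filter.mem_of_superset h1 (fun x hx => by simpa using hx)
  have hC := Filter.inter_mem hB hgt
  have hinf : (E ∩ {i | i ∈ E ∧ k < i ∧ F i ∈ V}ᶜ ∩ {i | k < i}).Infinite :=
    fun hfin => hU _ hfin hC
  have key : ∀ i ∈ (E ∩ {i | i ∈ E ∧ k < i ∧ F i ∈ V}ᶜ ∩ {i | k < i}),
      ∀ᶠ m in (V : Filter ℕ), i < m ∧ r i m < r k m := by
    rintro i ⟨⟨hiE, hi⟩, hki⟩
    have hki' : k < i := hki
    have hFi : F i ∉ V := fun h => hi ⟨hiE, hki, h⟩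
    have h1 : (F i)ᶜ ∈ V := Ultrafilter.compl_mem_iff_notMem.mpr hFi
    have h2 := Ultrafilter.compl_mem_iff_notMem.mpr (hV (Set.Iic i) (Set.finite_Iic i))
    filter_upwards [h1, h2, hD] with m hm1 hm2 hm3
    have him : i < m := by simpa using hm2
    refine ⟨him, ?_⟩
    have hne := hr1 k i m hki' him
    rw [hF] at hm1
    have : ¬ r k m < r i m := fun h => hm1 ⟨hm3, him, h⟩
    omega
  obtain ⟨i0, hi0⟩ := hinf.nonempty
  obtain ⟨T, hTs, hTc⟩ := hinf.exists_subset_card_eq (r k i0 + 1)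
  have hT : ∀ᶠ m in (V : Filter ℕ), ∀ i ∈ T, i < m ∧ r i m < r k m :=
    (Filter.eventually_all_finset T).mpr (fun i hi => key i (hTs hi))
  obtain ⟨m, hm0, hm⟩ := ((key i0 hi0).and hT).exists
  have hle : r k m ≤ r k i0 := by
    have h3 := hr3 k i0 m hi0.2 hm0.1
    rcases le_max_iff.mp h3 with h | h
    · exact h
    · have := hm0.2
      omega
  have hcard : (Finset.range (r k i0)).card < T.card := by
    rw [Finset.card_range, hTc]; omega
  obtain ⟨a, ha, b, hb, hab, heq⟩ := Finset.exists_ne_map_eq_of_card_lt_of_maps_to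
    (f := fun i => r i m) hcard (fun i hi => by
      have := (hm i hi).2
      simp only [Finset.coe_range, Set.mem_Iio]
      omega)
  rcases lt_or_gt_of_ne hab with h | h
  · exact hr1 a b m h (hm b hb).1 heq
  · exact hr1 b a m h (hm a ha).1 heq.symm
end

section
/- There do not exist u < ω and natural numbers i_0 < i_1 < … < i_{u+1} such that r(i_v, i_{v+1}) < u for every v ≤ u. -/
theorem stmt11
    (r : ℕ → ℕ → ℕ)
    (hr1 : ∀ k l m : ℕ, k < l → l < m → r k m ≠ r l m)
    (hr3 : ∀ k l m : ℕ, k < l → l < m → r k m ≤ max (r k l) (r l m)) :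
    ¬ ∃ (u : ℕ) (i : ℕ → ℕ),
        (∀ v ≤ u, i v < i (v + 1)) ∧
        (∀ v ≤ u, r (i v) (i (v + 1)) < u) := by
  rintro ⟨u, i, hi, hr⟩
  have mono : ∀ b, b ≤ u + 1 → ∀ a, a < b → i a < i b := by
    intro b
    induction b with
    | zero => intro _ a ha; omega
    | succ b ih =>
      intro hb a ha
      have h1 := hi b (by omega)
      rcases Nat.lt_succ_iff_lt_or_eq.mp ha with h | h
      · exact (ih (by omega) a h).trans h1
      · subst h; exact h1
  have key : ∀ d v, v + d = u → r (i v) (i (u + 1)) < u := by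
    intro d
    induction d with
    | zero => intro v hv; obtain rfl : v = u := by omega
              exact hr v le_rfl
    | succ d ih =>
      intro v hv
      have h1 := ih (v + 1) (by omega)
      have h2 := hr v (by omega)
      have h3 := hr3 (i v) (i (v + 1)) (i (u + 1)) (hi v (by omega))
        (mono _ le_rfl _ (by omega))
      exact h3.trans_lt (max_lt h2 h1)
  obtain ⟨x, hx, y, hy, hxy, he⟩ := Finset.exists_ne_map_eq_of_card_lt_of_maps_to
    (s := Finset.range (u + 1)) (t := Finset.range u) (by simp)
    (f := fun v => r (i v) (i (u + 1)))
    (by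
      intro v hv
      have hv' : v < u + 1 := by simpa using hv
      have := key (u - v) v (by omega)
      simpa using this)
  rw [Finset.mem_range] at hx hy
  rcases lt_or_gt_of_ne hxy with h | h
  · exact hr1 _ _ _ (mono y (by omega) x h) (mono _ le_rfl y hy) he
  · exact hr1 _ _ _ (mono x (by omega) y h) (mono _ le_rfl x hx) he.symm
end

section
/- For all natural numbers p, q, n, m with p < n, q < n, q ≠ p allowed to coincide, and n < m: if r(p,n) ≤ r(q,n) and r(q,m) < r(n,m), then r(p,m) < r(n,m). -/
theorem stmt12
    (r : ℕ → ℕ → ℕ)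
    (hr1 : ∀ k l m : ℕ, k < l → l < m → r k m ≠ r l m)
    (hr2 : ∀ k l m : ℕ, k < l → l < m → r k l ≤ max (r k m) (r l m))
    (hr3 : ∀ k l m : ℕ, k < l → l < m → r k m ≤ max (r k l) (r l m)) :
    ∀ p q n m : ℕ, p < n → q < n → n < m →
      r p n ≤ r q n → r q m < r n m → r p m < r n m := by
  intro p q n m hp hq hm h1 h2
  have a := hr2 q n m hq hm
  have b := hr3 p n m hp hm
  have c := hr1 p n m hp hm
  omega
end
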